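/- Let m, n ≥ 1, let ρ, σ be density matrices on ℂ^d, and let ϱ = ρ^{⊗m} ⊗ σ^{⊗n} be the corresponding matrix indexed by pairs (x, y) with x : Fin m → Fin d, y : Fin n → Fin d, having entry ∏_s ρ[x s, x' s] · ∏_t σ[y t, y' t]. For s ∈ Fin m and t ∈ Fin n, let X_{s,t} be the matrix whose ((x,y),(x',y')) entry is 1 if x'_i = x_i for all i ≠ s, y'_j = y_j for all j ≠ t, x'_s = y_t, and y'_t = x_s, and 0 otherwise (the operator swapping the s-th ρ-factor with the t-th σ-factor), and let O = (1/(mn))·Σ_{s,t} X_{s,t}. Then tr(ϱ·O) = tr(ρσ), and tr(ϱ·O²) − (tr(ϱ·O))² = 1/(mn) + ((1 − m − n)/(mn))·tr(ρσ)² + (1/n)(1 − 1/m)·tr(ρ²σ) + (1/m)(1 − 1/n)·tr(ρσ²). -/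

import Mathlib

open Matrix
open scoped ComplexOrder

/-- The state `ρ^{⊗m} ⊗ σ^{⊗n}` as a matrix indexed by pairs
`(x, y)` with `x : Fin m → Fin d`, `y : Fin n → Fin d`. -/
noncomputable def pairState (m n d : ℕ) (ρ σ : Matrix (Fin d) (Fin d) ℂ) :
    Matrix ((Fin m → Fin d) × (Fin n → Fin d)) ((Fin m → Fin d) × (Fin n → Fin d)) ℂ :=
  Matrix.of fun p q => (∏ s, ρ (p.1 s) (q.1 s)) * ∏ t, σ (p.2 t) (q.2 t)

/-- The operator `X_{s,t}` swapping the `s`-th ρ-factor with the `t`-th σ-factor. -/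
noncomputable def swapOp (m n d : ℕ) (s : Fin m) (t : Fin n) :
    Matrix ((Fin m → Fin d) × (Fin n → Fin d)) ((Fin m → Fin d) × (Fin n → Fin d)) ℂ :=
  Matrix.of fun p q =>
    if (∀ i, i ≠ s → q.1 i = p.1 i) ∧ (∀ j, j ≠ t → q.2 j = p.2 j) ∧
        q.1 s = p.2 t ∧ q.2 t = p.1 s
    then 1 else 0

/-- The observable `O_{(ρσ)} = (1/(mn)) Σ_{s,t} X_{s,t}`. -/
noncomputable def Oρσ (m n d : ℕ) :
    Matrix ((Fin m → Fin d) × (Fin n → Fin d)) ((Fin m → Fin d) × (Fin n → Fin d)) ℂ :=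
  (1 / ((m : ℂ) * (n : ℂ))) • ∑ s : Fin m, ∑ t : Fin n, swapOp m n d s t

/-- The tensor product `⨂ i, M i`, as a matrix indexed by functions `ι → D`. -/
noncomputable def tensorOp {ι D : Type*} [Fintype ι] (M : ι → Matrix D D ℂ) :
    Matrix (ι → D) (ι → D) ℂ :=
  Matrix.of fun z w => ∏ i, M i (z i) (w i)

/-- The operator permuting the tensor factors according to `π`. -/
noncomputable def permOp {ι : Type*} (D : Type*) [Fintype ι] [DecidableEq D]
    (π : Equiv.Perm ι) : Matrix (ι → D) (ι → D) ℂ :=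
  Matrix.of fun z w => if w = z ∘ π then 1 else 0

theorem permOp_mul {ι D : Type*} [Fintype ι] [DecidableEq ι] [Fintype D] [DecidableEq D]
    (π π' : Equiv.Perm ι) : permOp D π * permOp D π' = permOp D (π * π') := by
  ext z w
  simp only [permOp, Matrix.mul_apply, Matrix.of_apply]
  rw [Finset.sum_eq_single (z ∘ π) (fun j _ hj => by simp [hj]) (by simp)]
  simp only [if_true, one_mul]
  exact if_congr Iff.rfl rfl rfl

theorem trace_tensorOp_mul_permOp {ι D : Type*} [Fintype ι] [DecidableEq ι] [Fintype D]
    [DecidableEq D] (M : ι → Matrix D D ℂ) (π : Equiv.Perm ι) :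
    (tensorOp M * permOp D π).trace = ∑ z : ι → D, ∏ i, M i (z (π i)) (z i) := by
  simp only [tensorOp, permOp, Matrix.trace, Matrix.diag, Matrix.mul_apply, Matrix.of_apply,
    mul_ite, mul_one, mul_zero]
  rw [Finset.sum_comm]
  simp

theorem sum_fun_prod_subtype {ι D : Type*} [Fintype ι] [DecidableEq ι] [Fintype D]
    (p : ι → Prop) [DecidablePred p] (F : ({i // p i} → D) → ℂ)
    (g : {i // ¬ p i} → D → ℂ) (hg : ∀ i, ∑ a, g i a = 1) :
    ∑ z : ι → D, F (fun i => z i) * ∏ i : {i // ¬ p i}, g i (z i) = ∑ u, F u := by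
  refine ((Equiv.piEquivPiSubtypeProd p fun _ => D).sum_comp
    (fun uv => F uv.1 * ∏ i, g i (uv.2 i))).trans ?_
  rw [Fintype.sum_prod_type]
  refine Finset.sum_congr rfl fun u _ => ?_
  change ∑ v : {i // ¬ p i} → D, F u * ∏ i, g i (v i) = F u
  rw [← Finset.mul_sum, ← Fintype.prod_sum]
  simp [hg]

/-- The trace of a tensor product of unit-trace matrices against a permutation of the factors
depends only on the points `e j` outside of which the permutation is the identity. -/
theorem trace_tensorOp_mul_permOp_of_support {ι D : Type*} [Fintype ι] [DecidableEq ι]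
    [Fintype D] [DecidableEq D] (M : ι → Matrix D D ℂ) (hM : ∀ i, (M i).trace = 1)
    (π : Equiv.Perm ι) {k : ℕ} (e : Fin k → ι) (he : Function.Injective e)
    (τ : Fin k → Fin k) (hτ : ∀ j, π (e j) = e (τ j)) (hπ : ∀ i, (∀ j, i ≠ e j) → π i = i) :
    (tensorOp M * permOp D π).trace =
      ∑ w : Fin k → D, ∏ j, M (e j) (w (τ j)) (w j) := by
  classical
  obtain ⟨p, E, hE⟩ : ∃ (p : ι → Prop) (E : Fin k ≃ {i // p i}), ∀ j, (E j : ι) = e j :=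
    ⟨(· ∈ Set.range e), Equiv.ofInjective e he, fun _ => rfl⟩
  let G : (Fin k → D) → ℂ := fun w => ∏ j, M (e j) (w (τ j)) (w j)
  rw [trace_tensorOp_mul_permOp]
  refine Eq.trans ?_ ((E.arrowCongr (Equiv.refl D)).symm.sum_comp G)
  refine Eq.trans ?_ (sum_fun_prod_subtype p (fun u => G ((E.arrowCongr (Equiv.refl D)).symm u))
    (fun i a => M i a a) fun i => hM i)
  refine Finset.sum_congr rfl fun z _ => ?_
  rw [← Fintype.prod_subtype_mul_prod_subtype p, ← E.prod_comp]
  congr 1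
  · simp [G, hE, hτ]
  · refine Finset.prod_congr rfl fun i _ => ?_
    rw [hπ i fun j hj => i.2 (by rw [hj, ← hE]; exact (E j).2)]

theorem sum_fun_fin_succ {D : Type*} [Fintype D] {k : ℕ} (F : (Fin (k + 1) → D) → ℂ) :
    ∑ w, F w = ∑ a, ∑ w : Fin k → D, F (vecCons a w) := by
  rw [← (Fin.consEquiv fun _ => D).sum_comp, Fintype.sum_prod_type]
  rfl

theorem trace_mul_mul_eq_sum {D : Type*} [Fintype D] (A B C : Matrix D D ℂ) :
    (A * B * C).trace = ∑ a, ∑ b, ∑ c, A c a * (B a b * C b c) := by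
  rw [← Matrix.trace_mul_cycle B C A]
  simp only [Matrix.trace, Matrix.diag, Matrix.mul_apply, Finset.sum_mul]
  refine Finset.sum_congr rfl fun a _ => ?_
  rw [Finset.sum_comm]
  exact Finset.sum_congr rfl fun b _ => Finset.sum_congr rfl fun c _ => mul_comm _ _

theorem sum_ite_eq_else {k : ℕ} (i : Fin k) (a b : ℂ) :
    ∑ j, (if i = j then a else b) = a + ((k : ℂ) - 1) * b := by
  have h : ∀ j, (if i = j then a else b) = b + if i = j then a - b else 0 := by
    intro j; split_ifs <;> ring
  simp only [h, Finset.sum_add_distrib, Finset.sum_ite_eq, Finset.mem_univ, if_true,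
    Finset.sum_const, Finset.card_univ, Fintype.card_fin, nsmul_eq_mul]
  ring

/-- The identification of a function on a sum type with a pair of functions. -/
def pairEquiv (m n d : ℕ) :
    ((Fin m → Fin d) × (Fin n → Fin d)) ≃ (Fin m ⊕ Fin n → Fin d) :=
  (Equiv.sumArrowEquivProdArrow (Fin m) (Fin n) (Fin d)).symm

@[simp]
theorem pairEquiv_inl (m n d : ℕ) (p : (Fin m → Fin d) × (Fin n → Fin d)) (i : Fin m) :
    pairEquiv m n d p (Sum.inl i) = p.1 i := rfl

@[simp]
theorem pairEquiv_inr (m n d : ℕ) (p : (Fin m → Fin d) × (Fin n → Fin d)) (j : Fin n) :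
    pairEquiv m n d p (Sum.inr j) = p.2 j := rfl

theorem pairState_eq_submatrix (m n d : ℕ) (ρ σ : Matrix (Fin d) (Fin d) ℂ) :
    pairState m n d ρ σ =
      (tensorOp (Sum.elim (fun _ : Fin m => ρ) fun _ : Fin n => σ)).submatrix
        (pairEquiv m n d) (pairEquiv m n d) := by
  ext p q
  simp [pairState, tensorOp]

theorem swapOp_eq_submatrix (m n d : ℕ) (s : Fin m) (t : Fin n) :
    swapOp m n d s t =
      (permOp (Fin d) (Equiv.swap (Sum.inl s) (Sum.inr t))).submatrix
        (pairEquiv m n d) (pairEquiv m n d) := by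
  ext p q
  simp only [swapOp, permOp, Matrix.of_apply, Matrix.submatrix_apply]
  refine if_congr ?_ rfl rfl
  rw [funext_iff, Sum.forall]
  constructor
  · rintro ⟨h1, h2, h3, h4⟩
    refine ⟨fun i => ?_, fun j => ?_⟩
    · by_cases h : i = s
      · subst h; simpa using h3
      · simpa [Equiv.swap_apply_of_ne_of_ne, h] using h1 i h
    · by_cases h : j = t
      · subst h; simpa using h4
      · simpa [Equiv.swap_apply_of_ne_of_ne, h] using h2 j h
  · rintro ⟨h1, h2⟩
    refine ⟨fun i h => ?_, fun j h => ?_, ?_, ?_⟩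
    · simpa [Equiv.swap_apply_of_ne_of_ne, h] using h1 i
    · simpa [Equiv.swap_apply_of_ne_of_ne, h] using h2 j
    · simpa using h1 s
    · simpa using h2 t

theorem trace_submatrix_equiv_self {α β : Type*} [Fintype α] [Fintype β]
    (E : α ≃ β) (A : Matrix β β ℂ) : (A.submatrix E E).trace = A.trace :=
  E.sum_comp fun i => A i i

theorem trace_sum_elim {α β D : Type*} [Fintype D] {ρ σ : Matrix D D ℂ} (hρ : ρ.trace = 1)
    (hσ : σ.trace = 1) (i : α ⊕ β) :
    (Sum.elim (fun _ : α => ρ) (fun _ : β => σ) i).trace = 1 := by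
  cases i <;> simpa

theorem trace_pairState_mul_swapOp (m n d : ℕ) {ρ σ : Matrix (Fin d) (Fin d) ℂ}
    (hρ : ρ.trace = 1) (hσ : σ.trace = 1) (s : Fin m) (t : Fin n) :
    (pairState m n d ρ σ * swapOp m n d s t).trace = (ρ * σ).trace := by
  rw [pairState_eq_submatrix, swapOp_eq_submatrix, Matrix.submatrix_mul_equiv,
    trace_submatrix_equiv_self,
    trace_tensorOp_mul_permOp_of_support _ (trace_sum_elim hρ hσ) (Equiv.swap _ _) ![Sum.inl s, Sum.inr t]
      (by simp [Function.Injective, Fin.forall_fin_succ]) ![1, 0]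
      (by simp [Fin.forall_fin_succ])
      (fun i hi => Equiv.swap_apply_of_ne_of_ne (by simpa using hi 0) (by simpa using hi 1))]
  simp only [sum_fun_fin_succ, Matrix.trace, Matrix.diag, Matrix.mul_apply]
  rw [Finset.sum_comm]
  simp [Fin.prod_univ_succ]

theorem trace_pairState_mul_swapOp_mul_swapOp (m n d : ℕ) {ρ σ : Matrix (Fin d) (Fin d) ℂ}
    (hρ : ρ.trace = 1) (hσ : σ.trace = 1) (s s' : Fin m) (t t' : Fin n) :
    (pairState m n d ρ σ * (swapOp m n d s t * swapOp m n d s' t')).trace =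
      if s' = s then if t' = t then 1 else (ρ * σ ^ 2).trace
      else if t' = t then (ρ ^ 2 * σ).trace else (ρ * σ).trace ^ 2 := by
  simp only [pairState_eq_submatrix, swapOp_eq_submatrix, Matrix.submatrix_mul_equiv,
    trace_submatrix_equiv_self, permOp_mul]
  have hM := trace_sum_elim (α := Fin m) (β := Fin n) hρ hσ
  split_ifs with hs ht ht
  · subst hs ht
    rw [trace_tensorOp_mul_permOp_of_support _ hM _ ![] (fun i => i.elim0) ![]
      (fun i => i.elim0) (by simp)]
    simp
  · subst hs
    rw [trace_tensorOp_mul_permOp_of_support _ hM (_ * _) ![Sum.inl s', Sum.inr t, Sum.inr t']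
      (by simp [Function.Injective, Fin.forall_fin_succ, ht, Ne.symm ht]) ![2, 0, 1]
      (by simp [Fin.forall_fin_succ, Equiv.swap_apply_def, ht, Ne.symm ht])
      (fun i hi => by
        have h0 := hi 0
        have h1 := hi 1
        have h2 := hi 2
        simp at h0 h1 h2
        simp [Equiv.swap_apply_def, h0, h1, h2])]
    rw [pow_two, ← mul_assoc, trace_mul_mul_eq_sum]
    simp [sum_fun_fin_succ, Fin.prod_univ_succ]
  · subst ht
    rw [trace_tensorOp_mul_permOp_of_support _ hM (_ * _) ![Sum.inl s, Sum.inl s', Sum.inr t']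
      (by simp [Function.Injective, Fin.forall_fin_succ, hs, Ne.symm hs]) ![2, 0, 1]
      (by simp [Fin.forall_fin_succ, Equiv.swap_apply_def, hs, Ne.symm hs])
      (fun i hi => by
        have h0 := hi 0
        have h1 := hi 1
        have h2 := hi 2
        simp at h0 h1 h2
        simp [Equiv.swap_apply_def, h0, h1, h2])]
    rw [pow_two, trace_mul_mul_eq_sum]
    simp [sum_fun_fin_succ, Fin.prod_univ_succ]
  · rw [trace_tensorOp_mul_permOp_of_support _ hM (_ * _)
      ![Sum.inl s, Sum.inr t, Sum.inl s', Sum.inr t']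
      (by simp [Function.Injective, Fin.forall_fin_succ, hs, ht, Ne.symm hs, Ne.symm ht])
      ![1, 0, 3, 2]
      (by simp [Fin.forall_fin_succ, Equiv.swap_apply_def, hs, ht, Ne.symm hs, Ne.symm ht])
      (fun i hi => by
        have h0 := hi 0
        have h1 := hi 1
        have h2 := hi 2
        have h3 := hi 3
        simp at h0 h1 h2 h3
        simp [Equiv.swap_apply_def, h0, h1, h2, h3])]
    have h : (ρ * σ).trace = ∑ a, ∑ b, ρ b a * σ a b := by
      rw [Finset.sum_comm]
      simp [Matrix.trace, Matrix.mul_apply]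
    rw [h, pow_two]
    simp only [Finset.sum_mul]
    simp only [Finset.mul_sum]
    simp [sum_fun_fin_succ, Fin.prod_univ_succ, mul_assoc]

theorem stmt8 (m n d : ℕ) (hm : 1 ≤ m) (hn : 1 ≤ n)
    (ρ σ : Matrix (Fin d) (Fin d) ℂ)
    (hρ : ρ.PosSemidef) (hρtr : ρ.trace = 1)
    (hσ : σ.PosSemidef) (hσtr : σ.trace = 1) :
    (pairState m n d ρ σ * Oρσ m n d).trace = (ρ * σ).trace ∧
      (pairState m n d ρ σ * (Oρσ m n d) ^ 2).trace -
          ((pairState m n d ρ σ * Oρσ m n d).trace) ^ 2 =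
        1 / ((m : ℂ) * (n : ℂ)) +
          ((1 - (m : ℂ) - (n : ℂ)) / ((m : ℂ) * (n : ℂ))) * ((ρ * σ).trace) ^ 2 +
          (1 / (n : ℂ)) * (1 - 1 / (m : ℂ)) * (ρ ^ 2 * σ).trace +
          (1 / (m : ℂ)) * (1 - 1 / (n : ℂ)) * (ρ * σ ^ 2).trace := by
  have hm' : (m : ℂ) ≠ 0 := by exact_mod_cast (by omega : m ≠ 0)
  have hn' : (n : ℂ) ≠ 0 := by exact_mod_cast (by omega : n ≠ 0)
  have hmean : (pairState m n d ρ σ * Oρσ m n d).trace = (ρ * σ).trace := by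
    simp only [Oρσ, Matrix.mul_smul, Matrix.trace_smul, Matrix.mul_sum, Matrix.trace_sum,
      trace_pairState_mul_swapOp m n d hρtr hσtr, Finset.sum_const, Finset.card_univ,
      Fintype.card_fin, nsmul_eq_mul, smul_eq_mul]
    field_simp
  refine ⟨hmean, ?_⟩
  have hinner : ∀ s s' : Fin m, ∀ t' : Fin n,
      ∑ t, (pairState m n d ρ σ * (swapOp m n d s t * swapOp m n d s' t')).trace =
        if s' = s then 1 + ((n : ℂ) - 1) * (ρ * σ ^ 2).trace
        else (ρ ^ 2 * σ).trace + ((n : ℂ) - 1) * (ρ * σ).trace ^ 2 := by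
    intro s s' t'
    simp only [trace_pairState_mul_swapOp_mul_swapOp m n d hρtr hσtr]
    split_ifs <;> exact sum_ite_eq_else _ _ _
  rw [hmean, pow_two (Oρσ m n d)]
  simp only [Oρσ, Matrix.mul_smul, Matrix.smul_mul, Matrix.trace_smul, Matrix.mul_sum,
    Matrix.sum_mul, Matrix.trace_sum]
  simp only [hinner, sum_ite_eq_else, Finset.sum_const, Finset.card_univ, Fintype.card_fin,
    nsmul_eq_mul, smul_eq_mul]
  field_simp
  ring
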